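/- arXiv:1905.06427 — 2 statements merged into one kernel-verified Lean document; each statement's English description precedes it below -/
import Mathlib

section
/- Let a, b, c, d, ξ, y1 be real numbers with ξ > 0, a² + b·c = −ξ², d > 0 and y1 > 0, and let x, y : ℝ → ℝ be differentiable functions satisfying x'(s) = a·x(s) + b·y(s) and y'(s) = c·x(s) − a·y(s) + d for all s, with x(0) = 0 and y(0) = y1. Set t_r0 = −(1/ξ)·arccos(2d²/(d² + ξ²·y1²) − 1). Then −π/ξ < t_r0 < 0, x(t_r0) = 0 and y(t_r0) = −y1; moreover, if in addition b < 0, then x(s) > 0 for every s with t_r0 < s < 0. -/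
open Real

theorem right_half_return_time
    (a b c d ξ y1 : ℝ) (hξ : 0 < ξ) (habc : a ^ 2 + b * c = -ξ ^ 2)
    (hd : 0 < d) (hy1 : 0 < y1)
    (x y : ℝ → ℝ)
    (hx : ∀ s : ℝ, HasDerivAt x (a * x s + b * y s) s)
    (hy : ∀ s : ℝ, HasDerivAt y (c * x s - a * y s + d) s)
    (hx0 : x 0 = 0) (hy0 : y 0 = y1)
    (tr0 : ℝ)
    (htr0 : tr0 = -(1 / ξ) * Real.arccos (2 * d ^ 2 / (d ^ 2 + ξ ^ 2 * y1 ^ 2) - 1)) :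
    -π / ξ < tr0 ∧ tr0 < 0 ∧ x tr0 = 0 ∧ y tr0 = -y1 ∧
    (b < 0 → ∀ s : ℝ, tr0 < s → s < 0 → 0 < x s) := by
  have hξ0 : ξ ≠ 0 := hξ.ne'
  have hb : b ≠ 0 := by
    rintro rfl
    nlinarith [sq_nonneg a, pow_pos hξ 2]
  obtain ⟨X, hX⟩ : ∃ X : ℝ → ℝ, X = fun s => b * d / ξ ^ 2 * (1 - cos (ξ * s))
      + b * y1 / ξ * sin (ξ * s) := ⟨_, rfl⟩
  obtain ⟨Y, hY⟩ : ∃ Y : ℝ → ℝ, Y = fun s => -(a * d / ξ ^ 2) * (1 - cos (ξ * s))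
      + y1 * cos (ξ * s) + (d - a * y1) / ξ * sin (ξ * s) := ⟨_, rfl⟩
  have hlin : ∀ s : ℝ, HasDerivAt (fun s => ξ * s) ξ s := fun s => by
    simpa using (hasDerivAt_id s).const_mul ξ
  have hXd : ∀ s, HasDerivAt X (a * X s + b * Y s) s := by
    intro s
    rw [hX, hY]
    have h := (((hlin s).cos.const_sub 1).const_mul (b * d / ξ ^ 2)).add
      ((hlin s).sin.const_mul (b * y1 / ξ))
    refine h.congr_deriv ?_
    field_simp
    ring
  have hYd : ∀ s, HasDerivAt Y (c * X s - a * Y s + d) s := by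
    intro s
    rw [hX, hY]
    have h := ((((hlin s).cos.const_sub 1).const_mul (-(a * d / ξ ^ 2))).add
      ((hlin s).cos.const_mul y1)).add ((hlin s).sin.const_mul ((d - a * y1) / ξ))
    refine h.congr_deriv ?_
    have hbc : c = (-ξ ^ 2 - a ^ 2) / b := by
      field_simp
      linarith
    rw [hbc]
    field_simp
    ring
  have hX0 : X 0 = 0 := by simp [hX]
  have hY0 : Y 0 = y1 := by simp [hY]
  have key : ∀ s, x s = X s ∧ y s = Y s := by
    have hE : ∀ s, HasDerivAt (fun s => c * (x s - X s) ^ 2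
        - 2 * a * ((x s - X s) * (y s - Y s)) - b * (y s - Y s) ^ 2) 0 s := by
      intro s
      have hu := (hx s).sub (hXd s)
      have hv := (hy s).sub (hYd s)
      have h := (((hu.pow 2).const_mul c).sub ((hu.mul hv).const_mul (2 * a))).sub
        ((hv.pow 2).const_mul b)
      refine h.congr_deriv ?_
      simp only [Pi.sub_apply]
      push_cast
      ring
    intro s
    have hc := is_const_of_deriv_eq_zero (fun s => (hE s).differentiableAt)
      (fun s => (hE s).deriv) s 0
    simp only [hx0, hX0, hy0, hY0] at hc
    generalize hu : x s - X s = u at hc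
    generalize hv : y s - Y s = v at hc
    have h1 : (a * u + b * v) ^ 2 + (ξ * u) ^ 2 = 0 := by
      linear_combination (-b) * hc + u ^ 2 * habc
    have h2 : ξ * u = 0 := by nlinarith [sq_nonneg (a * u + b * v), sq_nonneg (ξ * u)]
    have hu0 : u = 0 := by simpa [hξ0] using h2
    have hv0 : v = 0 := by simpa [hu0, hb] using h1
    constructor <;> linarith
  have hD : 0 < d ^ 2 + ξ ^ 2 * y1 ^ 2 := by positivity
  obtain ⟨θ, hθ⟩ : ∃ θ, θ = Real.arccos (2 * d ^ 2 / (d ^ 2 + ξ ^ 2 * y1 ^ 2) - 1) := ⟨_, rfl⟩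
  rw [← hθ] at htr0
  have hlt1 : 2 * d ^ 2 / (d ^ 2 + ξ ^ 2 * y1 ^ 2) - 1 < 1 := by
    have : 2 * d ^ 2 / (d ^ 2 + ξ ^ 2 * y1 ^ 2) < 2 := by
      rw [div_lt_iff₀ hD]
      nlinarith [show 0 < ξ ^ 2 * y1 ^ 2 by positivity]
    linarith
  have hgt1 : -1 < 2 * d ^ 2 / (d ^ 2 + ξ ^ 2 * y1 ^ 2) - 1 := by
    have : 0 < 2 * d ^ 2 / (d ^ 2 + ξ ^ 2 * y1 ^ 2) := by positivity
    linarith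
  have hcos : cos θ = 2 * d ^ 2 / (d ^ 2 + ξ ^ 2 * y1 ^ 2) - 1 := by
    rw [hθ, Real.cos_arccos hgt1.le hlt1.le]
  have hθ0 : 0 < θ := by
    rw [hθ]; exact Real.arccos_pos.2 hlt1
  have hθπ : θ < π := by
    refine lt_of_le_of_ne (hθ ▸ Real.arccos_le_pi _) ?_
    intro h
    rw [h, cos_pi] at hcos
    linarith
  have hsin : sin θ = 2 * d * ξ * y1 / (d ^ 2 + ξ ^ 2 * y1 ^ 2) := by
    have h1 : 0 < sin θ := sin_pos_of_pos_of_lt_pi hθ0 hθπ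
    have h2 : 0 < 2 * d * ξ * y1 / (d ^ 2 + ξ ^ 2 * y1 ^ 2) := by positivity
    refine (pow_left_inj₀ h1.le h2.le two_ne_zero).1 ?_
    rw [sin_sq, hcos]
    field_simp
    ring
  have hst : ξ * tr0 = -θ := by
    rw [htr0]; field_simp
  have htr : tr0 = -θ / ξ := by
    rw [← hst]; field_simp
  refine ⟨?_, ?_, ?_, ?_, ?_⟩
  · rw [htr]; gcongr
  · rw [htr]; exact div_neg_of_neg_of_pos (by linarith) hξ
  · rw [(key tr0).1, hX]
    simp only [hst, cos_neg, sin_neg, hcos, hsin]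
    field_simp
    ring
  · rw [(key tr0).2, hY]
    simp only [hst, cos_neg, sin_neg, hcos, hsin]
    field_simp
    ring
  · intro hbn s hs1 hs2
    obtain ⟨p, hp⟩ : ∃ p, p = -(ξ * s) / 2 := ⟨_, rfl⟩
    obtain ⟨q, hq⟩ : ∃ q, q = θ / 2 := ⟨_, rfl⟩
    have hp0 : 0 < p := by rw [hp]; nlinarith
    have hpq : p < q := by rw [hp, hq]; nlinarith
    have hqπ : q < π / 2 := by rw [hq]; linarith
    have e1 : ξ * s = -(2 * p) := by rw [hp]; ring
    have e2 : θ = 2 * q := by rw [hq]; ring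
    have hsp : 0 < sin p := sin_pos_of_pos_of_lt_pi hp0 (by linarith)
    have hsq : 0 < sin q := sin_pos_of_pos_of_lt_pi (by linarith) (by linarith)
    have hcq : 0 < cos q := cos_pos_of_mem_Ioo ⟨by linarith, hqπ⟩
    have hrel : d * (1 - cos θ) = ξ * y1 * sin θ := by
      rw [hcos, hsin]; field_simp; ring
    have hrel2 : d * sin q = ξ * y1 * cos q := by
      rw [e2, cos_two_mul, sin_two_mul] at hrel
      have : sin q * (d * sin q) = sin q * (ξ * y1 * cos q) := by
        linear_combination hrel / 2 + d * sin_sq_add_cos_sq q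
      exact mul_left_cancel₀ hsq.ne' this
    have hdiff : 0 < sin (q - p) := sin_pos_of_pos_of_lt_pi (by linarith) (by linarith)
    rw [sin_sub] at hdiff
    have hpos : 0 < ξ * y1 * cos p - d * sin p := by
      have : 0 < cos q * (ξ * y1 * cos p - d * sin p) := by
        have h := mul_pos hd hdiff
        have e : cos q * (ξ * y1 * cos p - d * sin p)
            = d * (sin q * cos p - cos q * sin p) := by
          linear_combination (-cos p) * hrel2
        rw [e]; exact h
      exact pos_of_mul_pos_right this hcq.le
    have hfin : x s = 2 * (-b) * sin p / ξ ^ 2 * (ξ * y1 * cos p - d * sin p) := by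
      rw [(key s).1, hX]
      simp only [e1, cos_neg, sin_neg, cos_two_mul, sin_two_mul, cos_sq']
      field_simp
      ring
    rw [hfin]
    have : 0 < -b := by linarith
    positivity
end

section
/- Let β > 0 with β ≠ 1, and let K0, K1, K2 be real numbers, not all zero. Then the function M̃1(s) = K0·s + K1·(β²·s² + 1)·(arccos(2/(β²·s² + 1) − 1) − 2π) + K2·(s² + 1)·arccos(2/(s² + 1) − 1) has at most three zeros in the interval (0, ∞). -/
open Real Set

/-- `f` has (at least) `n` ordered positive zeros. -/
def HasPosZeros (n : ℕ) (f : ℝ → ℝ) : Prop :=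
  ∃ x : Fin n → ℝ, StrictMono x ∧ ∀ i, 0 < x i ∧ f (x i) = 0

lemma HasPosZeros.rolle {n : ℕ} {f f' : ℝ → ℝ} (hf : ∀ s, HasDerivAt f (f' s) s)
    (h : HasPosZeros (n + 1) f) : HasPosZeros n f' := by
  obtain ⟨x, hx, hz⟩ := h
  have key : ∀ i : Fin n, ∃ c ∈ Ioo (x i.castSucc) (x i.succ), f' c = 0 := by
    intro i
    apply exists_hasDerivAt_eq_zero (hx i.castSucc_lt_succ)
    · exact fun s _ => (hf s).continuousAt.continuousWithinAt
    · rw [(hz _).2, (hz _).2]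
    · exact fun s _ => hf s
  choose c hc hc0 using key
  refine ⟨c, ?_, fun i => ⟨(hz _).1.trans (hc i).1, hc0 i⟩⟩
  intro i j hij
  refine (hc i).2.trans_le (le_trans (hx.monotone ?_) (hc j).1.le)
  rw [Fin.le_def]
  simpa using hij

lemma hasPosZeros_of_encard {f : ℝ → ℝ} {n : ℕ}
    (h : (n : ℕ∞) ≤ {s : ℝ | 0 < s ∧ f s = 0}.encard) : HasPosZeros n f := by
  obtain ⟨t, ht, htn⟩ := Set.exists_subset_encard_eq h
  have hfin : t.Finite := Set.finite_of_encard_eq_coe htn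
  have hcard : hfin.toFinset.card = n := by
    rw [hfin.encard_eq_coe_toFinset_card] at htn
    exact_mod_cast htn
  refine ⟨hfin.toFinset.orderEmbOfFin hcard, OrderEmbedding.strictMono _, fun i => ?_⟩
  exact ht (hfin.mem_toFinset.1 (Finset.orderEmbOfFin_mem _ hcard i))

lemma HasPosZeros.exists {n : ℕ} {f : ℝ → ℝ} (h : HasPosZeros (n + 1) f) :
    ∃ s, 0 < s ∧ f s = 0 := by
  obtain ⟨x, -, hz⟩ := h
  exact ⟨x 0, hz 0⟩

lemma arccos_eq_two_arctan {t : ℝ} (ht : 0 < t) :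
    Real.arccos (2 / (t ^ 2 + 1) - 1) = 2 * arctan t := by
  have h0 : 0 < arctan t := arctan_pos.2 ht
  have h1 := arctan_lt_pi_div_two t
  rw [← Real.arccos_cos (x := 2 * arctan t) (by linarith) (by linarith)]
  congr 1
  rw [Real.cos_two_mul, Real.cos_sq_arctan]
  ring

/-- The function `u ↦ arctan u + u / (1 + u²)`. -/
noncomputable def gfun (u : ℝ) : ℝ := arctan u + u / (1 + u ^ 2)

lemma hasDerivAt_gfun (u : ℝ) : HasDerivAt gfun (2 / (1 + u ^ 2) ^ 2) u := by
  have hne : 1 + u ^ 2 ≠ 0 := by positivity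
  have h := (hasDerivAt_arctan u).add
    ((hasDerivAt_id u).div (((hasDerivAt_id u).pow 2).const_add 1) hne)
  refine h.congr_deriv ?_
  simp only [id, Pi.pow_apply]
  field_simp
  ring

lemma gfun_pos {u : ℝ} (hu : 0 < u) : 0 < gfun u := by
  have := arctan_pos.2 hu
  unfold gfun
  positivity

lemma gfun_lt_pi {u : ℝ} : gfun u < π := by
  have h1 := arctan_lt_pi_div_two u
  have h2 : u / (1 + u ^ 2) ≤ 1 / 2 := by
    rw [div_le_div_iff₀ (by positivity) (by norm_num)]
    nlinarith [sq_nonneg (u - 1)]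
  have := pi_gt_three
  unfold gfun
  linarith

lemma hasDerivAt_sq_arctan (b c s : ℝ) :
    HasDerivAt (fun s => (b ^ 2 * s ^ 2 + 1) * (arctan (b * s) - c))
      (2 * b ^ 2 * s * (arctan (b * s) - c) + b) s := by
  have hne : 1 + (b * s) ^ 2 ≠ 0 := by positivity
  have hb : HasDerivAt (fun s => b * s) b s := by simpa using (hasDerivAt_id s).const_mul b
  have h := ((((hasDerivAt_id s).pow 2).const_mul (b ^ 2)).add_const 1).mul
    (hb.arctan.sub_const c)
  refine h.congr_deriv ?_
  simp only [id, Pi.pow_apply]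
  field_simp
  push_cast
  ring

lemma hasDerivAt_second (b c s : ℝ) :
    HasDerivAt (fun s => 2 * b ^ 2 * s * (arctan (b * s) - c) + b)
      (2 * b ^ 2 * (gfun (b * s) - c)) s := by
  have hne : 1 + (b * s) ^ 2 ≠ 0 := by positivity
  have hb : HasDerivAt (fun s => b * s) b s := by simpa using (hasDerivAt_id s).const_mul b
  have h := (((hasDerivAt_id s).const_mul (2 * b ^ 2)).mul (hb.arctan.sub_const c)).add_const b
  refine h.congr_deriv ?_
  simp only [id, gfun]
  field_simp
  ring

lemma hasDerivAt_third (b c s : ℝ) :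
    HasDerivAt (fun s => 2 * b ^ 2 * (gfun (b * s) - c))
      (4 * b ^ 3 / (1 + (b * s) ^ 2) ^ 2) s := by
  have hb : HasDerivAt (fun s => b * s) b s := by simpa using (hasDerivAt_id s).const_mul b
  have h := (((hasDerivAt_gfun (b * s)).comp s hb).sub_const c).const_mul (2 * b ^ 2)
  refine h.congr_deriv ?_
  ring

theorem melnikov_at_most_three_zeros
    (β K0 K1 K2 : ℝ) (hβ : 0 < β) (hβ1 : β ≠ 1)
    (hK : ¬(K0 = 0 ∧ K1 = 0 ∧ K2 = 0))
    (M : ℝ → ℝ)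
    (hM : M = fun s =>
      K0 * s +
        K1 * (β ^ 2 * s ^ 2 + 1) *
          (Real.arccos (2 / (β ^ 2 * s ^ 2 + 1) - 1) - 2 * π) +
        K2 * (s ^ 2 + 1) * Real.arccos (2 / (s ^ 2 + 1) - 1)) :
    {s : ℝ | 0 < s ∧ M s = 0}.encard ≤ 3 := by
  by_contra hcon
  have h4 : ((4 : ℕ) : ℕ∞) ≤ {s : ℝ | 0 < s ∧ M s = 0}.encard := by
    have h := Order.add_one_le_of_lt (not_le.1 hcon)
    norm_num at h ⊢
    exact h
  obtain ⟨x, hx, hz⟩ := hasPosZeros_of_encard h4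
  set f0 : ℝ → ℝ := fun s => K0 * s
    + 2 * K1 * ((β ^ 2 * s ^ 2 + 1) * (arctan (β * s) - π))
    + 2 * K2 * ((1 ^ 2 * s ^ 2 + 1) * (arctan (1 * s) - 0)) with hf0
  have hP0 : HasPosZeros 4 f0 := by
    refine ⟨x, hx, fun i => ⟨(hz i).1, ?_⟩⟩
    have hi := (hz i).1
    have h := (hz i).2
    rw [hM] at h
    simp only at h
    rw [arccos_eq_two_arctan hi, ← mul_pow, arccos_eq_two_arctan (mul_pos hβ hi)] at h
    refine Eq.trans ?_ h
    simp only [hf0, one_mul]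
    ring
  set f1 : ℝ → ℝ := fun s => K0
    + 2 * K1 * (2 * β ^ 2 * s * (arctan (β * s) - π) + β)
    + 2 * K2 * (2 * 1 ^ 2 * s * (arctan (1 * s) - 0) + 1) with hf1
  set f2 : ℝ → ℝ := fun s => 2 * K1 * (2 * β ^ 2 * (gfun (β * s) - π))
    + 2 * K2 * (2 * 1 ^ 2 * (gfun (1 * s) - 0)) with hf2
  set f3 : ℝ → ℝ := fun s => 2 * K1 * (4 * β ^ 3 / (1 + (β * s) ^ 2) ^ 2)
    + 2 * K2 * (4 * 1 ^ 3 / (1 + (1 * s) ^ 2) ^ 2) with hf3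
  have d0 : ∀ s, HasDerivAt f0 (f1 s) s := fun s => by
    have h1 : HasDerivAt (fun s => K0 * s) K0 s := by
      simpa using (hasDerivAt_id s).const_mul K0
    exact (h1.add ((hasDerivAt_sq_arctan β π s).const_mul (2 * K1))).add
      ((hasDerivAt_sq_arctan 1 0 s).const_mul (2 * K2))
  have d1 : ∀ s, HasDerivAt f1 (f2 s) s := fun s =>
    (((hasDerivAt_second β π s).const_mul (2 * K1)).const_add K0).add
      ((hasDerivAt_second 1 0 s).const_mul (2 * K2))
  have d2 : ∀ s, HasDerivAt f2 (f3 s) s := fun s =>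
    ((hasDerivAt_third β π s).const_mul (2 * K1)).add
      ((hasDerivAt_third 1 0 s).const_mul (2 * K2))
  have hP1 := hP0.rolle d0
  have hP2 := hP1.rolle d1
  have hP3 := hP2.rolle d2
  obtain ⟨s, hs, hs2⟩ := hP2.exists
  obtain ⟨t, ht, ht3⟩ := hP3.exists
  -- second derivative: `K1 p = K2 q` with `p, q > 0`
  have hp : 0 < 2 * (2 * β ^ 2 * (π - gfun (β * s))) := by
    have := gfun_lt_pi (u := β * s)
    have : 0 < π - gfun (β * s) := by linarith
    positivity
  have hq : 0 < 2 * (2 * gfun s) := by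
    have := gfun_pos hs
    positivity
  have e2 : K1 * (2 * (2 * β ^ 2 * (π - gfun (β * s)))) = K2 * (2 * (2 * gfun s)) := by
    simp only [hf2, one_mul, one_pow, mul_one] at hs2
    linarith
  have hu : 0 < 2 * (4 * β ^ 3 / (1 + (β * t) ^ 2) ^ 2) := by positivity
  have hv : 0 < 2 * (4 * 1 ^ 3 / (1 + (1 * t) ^ 2) ^ 2) := by positivity
  have e3 : K1 * (2 * (4 * β ^ 3 / (1 + (β * t) ^ 2) ^ 2))
      + K2 * (2 * (4 * 1 ^ 3 / (1 + (1 * t) ^ 2) ^ 2)) = 0 := by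
    simp only [hf3] at ht3
    linarith
  have hK1 : K1 = 0 := by
    rcases lt_trichotomy K1 0 with h | h | h
    · have a := mul_neg_of_neg_of_pos h hp
      have b := mul_neg_of_neg_of_pos h hu
      have c : K2 < 0 := by
        by_contra hc
        have := mul_nonneg (not_lt.1 hc) hq.le
        linarith
      have := mul_neg_of_neg_of_pos c hv
      linarith
    · exact h
    · have a := mul_pos h hp
      have b := mul_pos h hu
      have c : 0 < K2 := by
        by_contra hc
        have := mul_nonpos_of_nonpos_of_nonneg (not_lt.1 hc) hq.le
        linarith
      have := mul_pos c hv
      linarith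
  have hK2 : K2 = 0 := by
    rw [hK1, zero_mul] at e2
    exact (mul_eq_zero.1 e2.symm).resolve_right hq.ne'
  obtain ⟨r, hr, hr0⟩ := hP0.exists
  refine hK ⟨?_, hK1, hK2⟩
  simp only [hf0, hK1, hK2, mul_zero, zero_mul, add_zero] at hr0
  exact (mul_eq_zero.1 hr0).resolve_right hr.ne'
end
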